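/- Let X ⊆ {0,1,…,m}^ℤ be an i-hereditary ℤ-subshift with positive topological entropy. Then for every measure of maximal entropy μ on X and every n ∈ ℤ_+, μ(0^n) ≤ e^{h_top(X)}·μ(0^{n+1}) (equivalently, h_top(X) ≥ log(μ(0^n)/μ(0^{n+1})) whenever μ(0^{n+1}) > 0). Furthermore, if X has the specification property at distance N, then μ(0^N) = e^{h_top(X)}·μ(0^{N+1}), i.e. h_top(X) = log(μ(0^N)/μ(0^{N+1})). -/

import Mathlib

open MeasureTheory Filter Real Topology

/-- The shift map on `A^ℤ`: `(σ x) i = x (i+1)`. -/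
def shiftMap (A : Type*) : (ℤ → A) → (ℤ → A) := fun x i => x (i + 1)

/-- A subshift: a nonempty, closed, shift-invariant subset of `A^ℤ`. -/
def IsSubshift {A : Type*} [TopologicalSpace A] (X : Set (ℤ → A)) : Prop :=
  X.Nonempty ∧ IsClosed X ∧ shiftMap A '' X = X

/-- Cylinder set of a word given as a list (placed on `[0, |u|)`). -/
def cylinderL {A : Type*} (X : Set (ℤ → A)) (u : List A) : Set (ℤ → A) :=
  {x ∈ X | ∀ i : Fin u.length, x ((i : ℕ) : ℤ) = u.get i}

/-- The language of `X`: all nonempty words appearing in points of `X`. -/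
def langL {A : Type*} (X : Set (ℤ → A)) : Set (List A) :=
  {u | u ≠ [] ∧ (cylinderL X u).Nonempty}

/-- The set of words of length `n` appearing in points of `X`. -/
def langF {A : Type*} (X : Set (ℤ → A)) (n : ℕ) : Set (Fin n → A) :=
  {w | ({x ∈ X | ∀ i : Fin n, x ((i : ℕ) : ℤ) = w i} : Set (ℤ → A)).Nonempty}

/-- The partial entropy sum `∑_{w ∈ A^n} -μ(w) log μ(w)`. -/
noncomputable def entropySumF {A : Type*} [Fintype A] [MeasurableSpace A]
    (X : Set (ℤ → A)) (μ : Measure (ℤ → A)) (n : ℕ) : ℝ :=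
  ∑ w : Fin n → A,
    -((μ {x ∈ X | ∀ i : Fin n, x ((i : ℕ) : ℤ) = w i}).toReal *
      Real.log (μ {x ∈ X | ∀ i : Fin n, x ((i : ℕ) : ℤ) = w i}).toReal)

/-- The extender set of a word `u`, as a set of pairs (left-infinite tail,
right-infinite tail); the left tail records `x (-1), x (-2), …` and the right tail
records `x |u|, x (|u|+1), …`. -/
def extenderL {A : Type*} (X : Set (ℤ → A)) (u : List A) : Set ((ℕ → A) × (ℕ → A)) :=
  {p | ∃ x ∈ cylinderL X u, (∀ i : ℕ, p.1 i = x (-(i : ℤ) - 1)) ∧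
    (∀ i : ℕ, p.2 i = x ((u.length : ℤ) + (i : ℤ)))}

/-- `X` is hereditary for the coordinatewise order. -/
def Hereditary {m : ℕ} (X : Set (ℤ → Fin (m + 1))) : Prop :=
  ∀ x y : ℤ → Fin (m + 1), y ∈ X → (∀ i : ℤ, x i ≤ y i) → x ∈ X

/-- `X` is i-hereditary: `X` is hereditary and inserting a `0` anywhere in a word of
the language keeps it in the language. -/
def IHereditary {m : ℕ} (X : Set (ℤ → Fin (m + 1))) : Prop :=
  Hereditary X ∧ ∀ u ∈ langL X, ∀ i ≤ u.length,
    (u.take i ++ [(0 : Fin (m + 1))] ++ u.drop i) ∈ langL X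

/-- `X` has the specification property at distance `N`. -/
def Specification {m : ℕ} (X : Set (ℤ → Fin (m + 1))) (N : ℕ) : Prop :=
  ∀ u w : List (Fin (m + 1)), u ∈ langL X → w ∈ langL X →
    ∃ v : List (Fin (m + 1)), v.length = N ∧ u ++ v ++ w ∈ langL X

section aux19

/-- Gibbs inequality. -/
lemma gibbs19 {ι : Type*} (s : Finset ι) (P Z : ι → ℝ) (hP : ∀ i ∈ s, 0 ≤ P i)
    (hZ : ∀ i ∈ s, 0 ≤ Z i) (hPZ : ∀ i ∈ s, 0 < P i → 0 < Z i) (T : ℝ) (hT : 0 < T)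
    (hs : ∑ i ∈ s, Z i ≤ T) :
    ∑ i ∈ s, -(P i * Real.log (P i)) + ∑ i ∈ s, P i * Real.log (Z i) ≤
      (∑ i ∈ s, P i) * Real.log T + 1 - ∑ i ∈ s, P i := by
  have key : ∀ i ∈ s, -(P i * Real.log (P i)) + P i * Real.log (Z i) - P i * Real.log T
      ≤ Z i / T - P i := by
    intro i hi
    rcases (hP i hi).eq_or_lt with h0 | h0
    · rw [← h0]; simp; exact div_nonneg (hZ i hi) hT.le
    · have hz := hPZ i hi h0
      have h1 := Real.log_le_sub_one_of_pos (show 0 < Z i / (P i * T) by positivity)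
      rw [Real.log_div hz.ne' (by positivity), Real.log_mul h0.ne' hT.ne'] at h1
      have h2 := mul_le_mul_of_nonneg_left h1 h0.le
      have h3 : P i * (Z i / (P i * T) - 1) = Z i / T - P i := by field_simp
      linarith
  have h1 := Finset.sum_le_sum key
  rw [Finset.sum_sub_distrib, Finset.sum_add_distrib, Finset.sum_sub_distrib,
    ← Finset.sum_mul, ← Finset.sum_div] at h1
  have h2 : (∑ i ∈ s, Z i) / T ≤ 1 := by rw [div_le_one hT]; exact hs
  linarith

lemma transfer19 {β γ : Type*} [DecidableEq β] [DecidableEq γ] (D E : Finset β)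
    (F : β → Finset γ) (yy xx : γ → β) (g : γ → ℝ) (e : β → ℝ)
    (h1 : ∀ y ∈ D, ∀ a ∈ F y, yy a = y ∧ xx a ∈ E)
    (h2 : ∀ x ∈ E, ∑ a ∈ (D.biUnion F).filter (fun a => xx a = x), g a ≤ e x) :
    ∑ y ∈ D, ∑ a ∈ F y, g a ≤ ∑ x ∈ E, e x := by
  rw [← Finset.sum_biUnion, ← Finset.sum_fiberwise_of_maps_to (g := xx) (t := E)]
  · exact Finset.sum_le_sum h2
  · intro a ha
    obtain ⟨y, hy, hay⟩ := Finset.mem_biUnion.1 ha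
    exact (h1 y hy a hay).2
  · intro y hy z hz hyz
    rw [Function.onFun, Finset.disjoint_left]
    intro a ha hb
    exact hyz ((h1 y hy a ha).1.symm.trans (h1 z hz a hb).1)

variable {m : ℕ}

/-- next state -/
def nx19 (n r : ℕ) (a : Fin (m + 1)) : ℕ := if a = 0 then min (r + 1) n else 0

def occ19 (n : ℕ) : ℕ → List (Fin (m + 1)) → ℕ
  | r, [] => if r = n then 1 else 0
  | r, a :: w => (if r = n then 1 else 0) + occ19 n (nx19 n r a) w

def cand19 (n : ℕ) : ℕ → List (Fin (m + 1)) → ℕ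
  | _, [] => 0
  | r, a :: w => (if r = n ∧ a = 0 then 1 else 0) + cand19 n (nx19 n r a) w

def st19 (n : ℕ) : ℕ → List (Fin (m + 1)) → ℕ
  | r, [] => r
  | r, a :: w => st19 n (nx19 n r a) w

def valid19 (n : ℕ) : ℕ → List (Option (Fin (m + 1))) → Prop
  | _, [] => True
  | r, none :: w => r = n ∧ valid19 n r w
  | r, some a :: w => valid19 n (nx19 n r a) w

def xw19 : List (Option (Fin (m + 1))) → List (Fin (m + 1))
  | [] => []
  | none :: w => 0 :: xw19 w
  | some a :: w => a :: xw19 w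

def yw19 : List (Option (Fin (m + 1))) → List (Fin (m + 1))
  | [] => []
  | none :: w => yw19 w
  | some a :: w => a :: yw19 w

def nn19 : List (Option (Fin (m + 1))) → ℕ
  | [] => 0
  | none :: w => nn19 w + 1
  | some _ :: w => nn19 w

def AX19 (n : ℕ) : ℕ → List (Fin (m + 1)) → Finset (List (Option (Fin (m + 1))))
  | _, [] => {[]}
  | r, a :: w => (AX19 n (nx19 n r a) w).image (List.cons (some a)) ∪
      if r = n ∧ a = 0 then (AX19 n (nx19 n r a) w).image (List.cons none) else ∅

def AY19 (n : ℕ) : ℕ → List (Fin (m + 1)) → Finset (List (Option (Fin (m + 1))))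
  | r, [] => {[]} ∪ if r = n then {[none]} else ∅
  | r, a :: w => (AY19 n (nx19 n r a) w).image (List.cons (some a)) ∪
      if r = n then ((AY19 n (nx19 n r a) w).image (List.cons (some a))).image (List.cons none)
      else ∅

def V19 (n : ℕ) : ℕ → ℕ → List (Fin (m + 1)) → Finset (List (Option (Fin (m + 1))))
  | 0, _, [] => {[]}
  | 0, _, _ :: _ => ∅
  | k + 1, r, [] => {[]} ∪ if r = n then (V19 n k r []).image (List.cons none) else ∅
  | k + 1, r, a :: w => (V19 n k (nx19 n r a) w).image (List.cons (some a)) ∪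
      if r = n then (V19 n k r (a :: w)).image (List.cons none) else ∅

lemma nx19_zero (n : ℕ) : nx19 n n (0 : Fin (m + 1)) = n := by simp [nx19]

lemma sum_cons19 {γ : Type*} [DecidableEq γ] (S : Finset (List γ)) (c : γ) (f : List γ → ℝ) :
    ∑ a ∈ S.image (List.cons c), f a = ∑ a ∈ S, f (c :: a) := by
  rw [Finset.sum_image]
  intro a _ b _ h
  simpa using h

lemma len19 (w : List (Option (Fin (m + 1)))) :
    (xw19 w).length = w.length ∧ (xw19 w).length = (yw19 w).length + nn19 w := by
  induction w with
  | nil => simp [xw19, yw19, nn19]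
  | cons a w ih =>
    cases a <;> simp [xw19, yw19, nn19] <;> omega

lemma cand_occ19 (n : ℕ) (w : List (Option (Fin (m + 1)))) : ∀ r, valid19 n r w →
    cand19 n r (xw19 w) = cand19 n r (yw19 w) + nn19 w ∧
    occ19 n r (xw19 w) = occ19 n r (yw19 w) + nn19 w := by
  induction w with
  | nil => intro r _; simp [xw19, yw19, nn19]
  | cons a w ih =>
    intro r hv
    cases a with
    | none =>
      obtain ⟨rfl, hv⟩ := hv
      have := ih _ hv
      simp only [xw19, yw19, nn19, cand19, occ19, nx19_zero]
      simp; omega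
    | some a =>
      have := ih _ hv
      simp only [xw19, yw19, nn19, cand19, occ19]
      omega

lemma mem_AX19 (n : ℕ) (x : List (Fin (m + 1))) : ∀ r w, w ∈ AX19 n r x →
    valid19 n r w ∧ xw19 w = x := by
  induction x with
  | nil => intro r w hw; simp [AX19] at hw; subst hw; simp [valid19, xw19]
  | cons a x ih =>
    intro r w hw
    rw [AX19, Finset.mem_union] at hw
    rcases hw with hw | hw
    · obtain ⟨w', hw', rfl⟩ := Finset.mem_image.1 hw
      have := ih _ _ hw'
      simpa [valid19, xw19] using this
    · split_ifs at hw with hc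
      · obtain ⟨rfl, rfl⟩ := hc
        obtain ⟨w', hw', rfl⟩ := Finset.mem_image.1 hw
        have := ih _ _ hw'
        rw [nx19_zero] at this
        simpa [valid19, xw19] using this
      · simp at hw

lemma AX19_mem (n : ℕ) (w : List (Option (Fin (m + 1)))) : ∀ r, valid19 n r w →
    w ∈ AX19 n r (xw19 w) := by
  induction w with
  | nil => intro r _; simp [AX19, xw19]
  | cons a w ih =>
    intro r hv
    cases a with
    | none =>
      obtain ⟨rfl, hv⟩ := hv
      have := ih _ hv
      simp [AX19, xw19, nx19_zero, this]
    | some a =>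
      have := ih _ hv
      simp [AX19, xw19, this]

lemma mem_AY19 (n : ℕ) (y : List (Fin (m + 1))) : ∀ r w, w ∈ AY19 n r y →
    valid19 n r w ∧ yw19 w = y ∧ w.length ≤ 2 * y.length + 1 := by
  induction y with
  | nil =>
    intro r w hw
    rw [AY19, Finset.mem_union] at hw
    rcases hw with hw | hw
    · simp at hw; subst hw; simp [valid19, yw19]
    · split_ifs at hw with hc
      · simp at hw; subst hw; simp [valid19, yw19, hc]
      · simp at hw
  | cons a y ih =>
    intro r w hw
    rw [AY19, Finset.mem_union] at hw
    rcases hw with hw | hw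
    · obtain ⟨w', hw', rfl⟩ := Finset.mem_image.1 hw
      have := ih _ _ hw'
      refine ⟨by simpa [valid19] using this.1, by simpa [yw19] using this.2.1, ?_⟩
      simp; omega
    · split_ifs at hw with hc
      · obtain ⟨w', hw', rfl⟩ := Finset.mem_image.1 hw
        obtain ⟨v2, hv2, rfl⟩ := Finset.mem_image.1 hw'
        have := ih _ _ hv2
        refine ⟨by simpa [valid19, hc] using this.1, by simpa [yw19] using this.2.1, ?_⟩
        simp; omega
      · simp at hw

lemma V19_mem (n : ℕ) (w : List (Option (Fin (m + 1)))) : ∀ k r, w.length ≤ k → valid19 n r w →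
    w ∈ V19 n k r (yw19 w) := by
  induction w with
  | nil => intro k r _ _; cases k <;> simp [V19, yw19]
  | cons a w ih =>
    intro k r hk hv
    obtain ⟨k, rfl⟩ : ∃ k', k = k' + 1 := ⟨k - 1, by simp at hk; omega⟩
    have hk' : w.length ≤ k := by simpa using hk
    cases a with
    | none =>
      obtain ⟨rfl, hv⟩ := hv
      have := ih k _ hk' hv
      simp only [yw19]
      generalize yw19 w = y at *
      cases y <;> simp [V19, this]
    | some a =>
      have := ih k _ hk' hv
      simp [V19, yw19, this]

lemma disj19 {γ : Type*} [DecidableEq γ] (S T : Finset (List (Option γ))) (a : γ) :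
    Disjoint (S.image (List.cons (some a))) (T.image (List.cons none)) := by
  rw [Finset.disjoint_left]
  intro w hw hw'
  obtain ⟨w1, _, rfl⟩ := Finset.mem_image.1 hw
  obtain ⟨w2, _, h⟩ := Finset.mem_image.1 hw'
  simp at h

lemma sum_AX19 (n : ℕ) (s : ℝ) (x : List (Fin (m + 1))) : ∀ r,
    ∑ w ∈ AX19 n r x, s ^ nn19 w = (1 + s) ^ cand19 n r x := by
  induction x with
  | nil => intro r; simp [AX19, cand19, nn19]
  | cons a x ih =>
    intro r
    rw [AX19, cand19]
    split_ifs with hc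
    · rw [Finset.sum_union (disj19 _ _ _), sum_cons19, sum_cons19]
      simp only [nn19, pow_succ, ← Finset.sum_mul, ih]
      ring
    · rw [Finset.union_empty, sum_cons19]
      simp only [nn19, ih]
      simp

lemma sum_AY19 (n : ℕ) (s : ℝ) (x : List (Fin (m + 1))) : ∀ r,
    ∑ w ∈ AY19 n r x, s ^ nn19 w = (1 + s) ^ occ19 n r x := by
  induction x with
  | nil =>
    intro r
    rw [AY19, occ19]
    split_ifs
    · rw [Finset.sum_union (by simp)]; simp [nn19]
    · simp [nn19]
  | cons a x ih =>
    intro r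
    rw [AY19, occ19]
    split_ifs with hc
    · rw [Finset.sum_union (disj19 _ _ _), sum_cons19, sum_cons19, sum_cons19]
      simp only [nn19, pow_succ, ← Finset.sum_mul, ih]
      ring
    · rw [Finset.union_empty, sum_cons19]
      simp only [nn19, ih]
      simp

lemma sum_V19 (n : ℕ) (s : ℝ) (hs : 0 ≤ s) (hs1 : s < 1) : ∀ (k r : ℕ) (y : List (Fin (m + 1))),
    ∑ w ∈ V19 n k r y, s ^ nn19 w ≤ ((1 - s)⁻¹) ^ occ19 n r y := by
  have h1 : 1 ≤ (1 - s)⁻¹ := by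
    rw [one_le_inv₀ (by linarith)]; linarith
  have h2 : 1 + s * (1 - s)⁻¹ = (1 - s)⁻¹ := by
    have : 1 - s ≠ 0 := by linarith
    field_simp; ring
  intro k
  induction k with
  | zero =>
    intro r y
    cases y with
    | nil => simp only [V19, Finset.sum_singleton, nn19, pow_zero]; exact one_le_pow₀ h1
    | cons a y => simp only [V19, Finset.sum_empty]; positivity
  | succ k ih =>
    intro r y
    cases y with
    | nil =>
      rw [V19, occ19]
      split_ifs with hc
      · have hd : Disjoint ({[]} : Finset (List (Option (Fin (m + 1)))))
            ((V19 n k r []).image (List.cons none)) := by simp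
        rw [Finset.sum_union hd, sum_cons19]
        have := ih r []
        simp only [occ19, hc, if_true, pow_one] at this
        simp only [nn19, pow_succ, ← Finset.sum_mul, Finset.sum_singleton, hc]
        nlinarith
      · simp [nn19]
    | cons a y =>
      have i1 := ih (nx19 n r a) y
      have i2 := ih r (a :: y)
      rw [V19, occ19]
      rw [occ19] at i2
      split_ifs at i2 ⊢ with hc
      · rw [Finset.sum_union (disj19 _ _ _), sum_cons19, sum_cons19]
        simp only [nn19, pow_succ, ← Finset.sum_mul]
        rw [pow_add, pow_one] at i2 ⊢
        calc _ ≤ ((1 - s)⁻¹) ^ occ19 n (nx19 n r a) y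
              + (1 - s)⁻¹ * ((1 - s)⁻¹) ^ occ19 n (nx19 n r a) y * s :=
              add_le_add i1 (mul_le_mul_of_nonneg_right i2 hs)
          _ = (1 + s * (1 - s)⁻¹) * ((1 - s)⁻¹) ^ occ19 n (nx19 n r a) y := by ring
          _ = _ := by rw [h2]
      · rw [Finset.union_empty, sum_cons19]
        simpa only [nn19, zero_add] using i1

lemma mem_V19 (n : ℕ) : ∀ (k r : ℕ) (y : List (Fin (m + 1))), ∀ w ∈ V19 n k r y,
    yw19 w = y := by
  intro k
  induction k with
  | zero =>
    intro r y w hw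
    cases y with
    | nil => simp [V19] at hw; subst hw; rfl
    | cons a y => simp [V19] at hw
  | succ k ih =>
    intro r y w hw
    cases y with
    | nil =>
      rw [V19, Finset.mem_union] at hw
      rcases hw with hw | hw
      · simp at hw; subst hw; rfl
      · split_ifs at hw
        · obtain ⟨w', hw', rfl⟩ := Finset.mem_image.1 hw
          rw [yw19]; exact ih _ _ _ hw'
        · simp at hw
    | cons a y =>
      rw [V19, Finset.mem_union] at hw
      rcases hw with hw | hw
      · obtain ⟨w', hw', rfl⟩ := Finset.mem_image.1 hw
        rw [yw19, ih _ _ _ hw']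
      · split_ifs at hw
        · obtain ⟨w', hw', rfl⟩ := Finset.mem_image.1 hw
          rw [yw19]; exact ih _ _ _ hw'
        · simp at hw

lemma mem_cyl19 {A : Type*} (X : Set (ℤ → A)) (u : List A) (x : ℤ → A) :
    x ∈ cylinderL X u ↔ x ∈ X ∧ ∀ (i : ℕ) (hi : i < u.length), x (i : ℤ) = u[i] := by
  constructor
  · rintro ⟨h1, h2⟩
    exact ⟨h1, fun i hi => h2 ⟨i, hi⟩⟩
  · rintro ⟨h1, h2⟩
    exact ⟨h1, fun i => h2 i i.2⟩

lemma shift_mem19 {A : Type*} [TopologicalSpace A] {X : Set (ℤ → A)} (hX : IsSubshift X)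
    (x : ℤ → A) (hx : x ∈ X) (k : ℕ) : (fun i : ℤ => x (i + k)) ∈ X := by
  induction k with
  | zero => simpa using hx
  | succ k ih =>
    rw [← hX.2.2]
    refine ⟨_, ih, ?_⟩
    funext i
    simp only [shiftMap]
    congr 1
    push_cast; ring

lemma suffix19 {A : Type*} [TopologicalSpace A] {X : Set (ℤ → A)} (hX : IsSubshift X)
    (p w : List A) (h : (cylinderL X (p ++ w)).Nonempty) : (cylinderL X w).Nonempty := by
  obtain ⟨x, hx⟩ := h
  rw [mem_cyl19] at hx
  refine ⟨_, (mem_cyl19 _ _ _).2 ⟨shift_mem19 hX x hx.1 p.length, ?_⟩⟩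
  intro i hi
  have := hx.2 (i + p.length) (by simp; omega)
  push_cast at this
  rw [this, List.getElem_append_right (by omega)]
  simp

lemma prefix19 {A : Type*} {X : Set (ℤ → A)}
    (p w : List A) (h : (cylinderL X (p ++ w)).Nonempty) : (cylinderL X p).Nonempty := by
  obtain ⟨x, hx⟩ := h
  rw [mem_cyl19] at hx
  refine ⟨x, (mem_cyl19 _ _ _).2 ⟨hx.1, ?_⟩⟩
  intro i hi
  rw [hx.2 i (by simp; omega), List.getElem_append_left]

lemma zero_mid19 {X : Set (ℤ → Fin (m + 1))} (hH : Hereditary X)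
    (p v w : List (Fin (m + 1))) (h : (cylinderL X (p ++ v ++ w)).Nonempty) :
    (cylinderL X (p ++ List.replicate v.length 0 ++ w)).Nonempty := by
  obtain ⟨x, hx⟩ := h
  rw [mem_cyl19] at hx
  refine ⟨fun i => if (p.length : ℤ) ≤ i ∧ i < p.length + v.length then 0 else x i,
    (mem_cyl19 _ _ _).2 ⟨hH _ x hx.1 ?_, ?_⟩⟩
  · intro i
    split_ifs
    · exact Fin.zero_le _
    · exact le_rfl
  · intro i hi
    have hi' : i < (p ++ v ++ w).length := by simpa using hi
    have hxi := hx.2 i hi'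
    split_ifs with hc
    · rw [List.getElem_append_left (by simp; omega), List.getElem_append_right (by omega)]
      simp
    · rw [hxi]
      by_cases h1 : i < p.length
      · rw [List.getElem_append_left (by simp; omega), List.getElem_append_left h1,
          List.getElem_append_left (by simp; omega), List.getElem_append_left h1]
      · rw [List.getElem_append_right (by simp; omega), List.getElem_append_right (by simp; omega)]
        simp

lemma spec_del19 {X : Set (ℤ → Fin (m + 1))} (hX : IsSubshift X) (hH : Hereditary X) (N : ℕ)
    (hS : Specification X N) (p w : List (Fin (m + 1)))
    (h : (cylinderL X (p ++ List.replicate N 0 ++ 0 :: w)).Nonempty) :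
    (cylinderL X (p ++ List.replicate N 0 ++ w)).Nonempty := by
  by_cases hp : p = []
  · subst hp
    apply suffix19 hX [0]
    have : [0] ++ ([] ++ List.replicate N (0 : Fin (m + 1)) ++ w)
        = [] ++ List.replicate N 0 ++ 0 :: w := by
      simp only [List.nil_append]
      rw [← List.append_assoc, show [(0 : Fin (m + 1))] ++ List.replicate N 0 =
        List.replicate N 0 ++ [0] by rw [← List.replicate_succ', List.replicate_succ]; rfl]
      simp
    rw [this]; exact h
  · by_cases hw : w = []
    · subst hw
      rw [List.append_nil]
      exact prefix19 _ _ h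
    · have h1 : p ∈ langL X := ⟨hp, by rw [List.append_assoc] at h; exact prefix19 _ _ h⟩
      have h2 : w ∈ langL X := ⟨hw, by
        apply suffix19 hX (p ++ List.replicate N 0 ++ [0])
        simpa using h⟩
      obtain ⟨v, hv, hl⟩ := hS p w h1 h2
      rw [← hv]
      exact zero_mid19 hH _ _ _ hl.2

lemma goal1_lang19 {X : Set (ℤ → Fin (m + 1))} (hI : IHereditary X)
    (w : List (Option (Fin (m + 1)))) : ∀ p : List (Fin (m + 1)), p ++ yw19 w ≠ [] →
    (cylinderL X (p ++ yw19 w)).Nonempty → (cylinderL X (p ++ xw19 w)).Nonempty := by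
  induction w with
  | nil => intro p _ h; simpa [xw19, yw19] using h
  | cons a w ih =>
    intro p hp h
    cases a with
    | none =>
      have h1 := hI.2 (p ++ yw19 w) ⟨hp, h⟩ p.length (by simp)
      simp only [List.take_left, List.drop_left] at h1
      have := ih (p ++ [0]) h1.1 h1.2
      simpa [xw19] using this
    | some a =>
      have := ih (p ++ [a]) (by simp) (by simpa [yw19] using h)
      simpa [xw19] using this

lemma goal2_lang19 {X : Set (ℤ → Fin (m + 1))} (hX : IsSubshift X) (hH : Hereditary X) (N : ℕ)
    (hS : Specification X N)
    (w : List (Option (Fin (m + 1)))) : ∀ (r : ℕ) (p : List (Fin (m + 1))), r ≤ N →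
    valid19 N r w →
    (cylinderL X (p ++ List.replicate r 0 ++ xw19 w)).Nonempty →
    (cylinderL X (p ++ List.replicate r 0 ++ yw19 w)).Nonempty := by
  induction w with
  | nil => intro r p _ _ h; simpa [xw19, yw19] using h
  | cons a w ih =>
    intro r p hr hv h
    cases a with
    | none =>
      obtain ⟨rfl, hv⟩ := hv
      exact ih _ p hr hv (spec_del19 hX hH _ hS _ _ h)
    | some a =>
      rw [valid19] at hv
      simp only [xw19, yw19] at h ⊢
      by_cases ha : a = 0
      · subst ha
        by_cases hrN : r = N
        · subst hrN
          rw [nx19_zero] at hv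
          have e : ∀ z : List (Fin (m + 1)), p ++ List.replicate r 0 ++ 0 :: z
              = (p ++ [0]) ++ List.replicate r 0 ++ z := by
            intro z
            have : [(0 : Fin (m + 1))] ++ List.replicate r 0 =
              List.replicate r 0 ++ [0] := by rw [← List.replicate_succ', List.replicate_succ]; rfl
            rw [List.append_assoc p [0], this]; simp
          rw [e] at h ⊢
          exact ih r _ hr hv h
        · have e1 : nx19 N r (0 : Fin (m + 1)) = r + 1 := by simp [nx19]; omega
          rw [e1] at hv
          have e : ∀ z : List (Fin (m + 1)), p ++ List.replicate r 0 ++ 0 :: z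
              = p ++ List.replicate (r + 1) 0 ++ z := by
            intro z
            rw [List.replicate_succ']; simp
          rw [e] at h ⊢
          exact ih _ _ (by omega) hv h
      · have e1 : nx19 N r a = 0 := by simp [nx19, ha]
        rw [e1] at hv
        have := ih 0 (p ++ List.replicate r 0 ++ [a]) (by omega) hv (by simpa using h)
        simpa using this

lemma langF_iff19 {A : Type*} (X : Set (ℤ → A)) (n : ℕ) (w : Fin n → A) :
    {x ∈ X | ∀ i : Fin n, x ((i : ℕ) : ℤ) = w i} = cylinderL X (List.ofFn w) := by
  ext x
  rw [mem_cyl19]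
  simp only [Set.mem_ofPred_eq, List.getElem_ofFn, List.length_ofFn]
  constructor
  · rintro ⟨h1, h2⟩; exact ⟨h1, fun i hi => h2 ⟨i, hi⟩⟩
  · rintro ⟨h1, h2⟩; exact ⟨h1, fun i => h2 i i.2⟩

/-- words of length l -/
noncomputable def D19 (X : Set (ℤ → Fin (m + 1))) (l : ℕ) : Finset (List (Fin (m + 1))) :=
  (Set.toFinite (langF X l)).toFinset.image List.ofFn

lemma mem_D19 (X : Set (ℤ → Fin (m + 1))) (l : ℕ) (u : List (Fin (m + 1))) :
    u ∈ D19 X l ↔ u.length = l ∧ (cylinderL X u).Nonempty := by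
  simp only [D19, Finset.mem_image, Set.Finite.mem_toFinset, langF, Set.mem_ofPred_eq, langF_iff19]
  constructor
  · rintro ⟨w, hw, rfl⟩
    exact ⟨by simp, hw⟩
  · rintro ⟨rfl, hu⟩
    exact ⟨u.get, by simpa using hu, by simp⟩

lemma card_D19 (X : Set (ℤ → Fin (m + 1))) (l : ℕ) : (D19 X l).card = (langF X l).ncard := by
  rw [D19, Finset.card_image_of_injective _ List.ofFn_injective,
    Set.ncard_eq_toFinset_card _ (Set.toFinite _)]

lemma sum_D19 (X : Set (ℤ → Fin (m + 1))) (l : ℕ) (f : List (Fin (m + 1)) → ℝ) :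
    ∑ u ∈ D19 X l, f u = ∑ w ∈ (Set.toFinite (langF X l)).toFinset, f (List.ofFn w) := by
  rw [D19, Finset.sum_image (fun a _ b _ h => List.ofFn_injective h)]

/-- words of length `< K` -/
noncomputable def E19 (X : Set (ℤ → Fin (m + 1))) (K : ℕ) : Finset (List (Fin (m + 1))) :=
  (Finset.range K).biUnion (D19 X)

lemma sum_E19 (X : Set (ℤ → Fin (m + 1))) (K : ℕ) (h' C : ℝ)
    (hC : ∀ l, ((langF X l).ncard : ℝ) ≤ C * Real.exp (h' * l)) :
    ∑ u ∈ E19 X K, Real.exp (-(h' * u.length)) ≤ C * K := by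
  rw [E19, Finset.sum_biUnion]
  · calc _ ≤ ∑ l ∈ Finset.range K, C := by
          apply Finset.sum_le_sum
          intro l _
          rw [Finset.sum_congr rfl (g := fun _ => Real.exp (-(h' * l)))]
          · rw [Finset.sum_const, card_D19, nsmul_eq_mul]
            calc _ ≤ C * Real.exp (h' * l) * Real.exp (-(h' * l)) :=
                  mul_le_mul_of_nonneg_right (hC l) (Real.exp_pos _).le
              _ = C := by rw [mul_assoc, ← Real.exp_add]; simp
          · intro u hu
            rw [((mem_D19 _ _ _).1 hu).1]
      _ = C * K := by simp [mul_comm]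
  · intro a _ b _ hab
    rw [Function.onFun, Finset.disjoint_left]
    intro u hu hu'
    exact hab (((mem_D19 _ _ _).1 hu).1.symm.trans ((mem_D19 _ _ _).1 hu').1)

lemma mem_E19 (X : Set (ℤ → Fin (m + 1))) (K : ℕ) (u : List (Fin (m + 1))) :
    u ∈ E19 X K ↔ u.length < K ∧ (cylinderL X u).Nonempty := by
  simp [E19, mem_D19]

/-- counting bound, insertion -/
lemma count1_19 {X : Set (ℤ → Fin (m + 1))} (hI : IHereditary X) (n : ℕ) (h' C s : ℝ)
    (hs : 0 < s) (hC : ∀ l, ((langF X l).ncard : ℝ) ≤ C * Real.exp (h' * l)) (L : ℕ) (hL : 0 < L) :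
    ∑ y ∈ D19 X L, Real.exp (-(h' * L)) * (((1 + s)⁻¹) ^ cand19 n 0 y *
      (1 + s * Real.exp (-h') * (1 + s)⁻¹) ^ occ19 n 0 y) ≤ C * (2 * L + 2) := by
  have hs1 : 0 < 1 + s := by linarith
  have hs2 : (1 + s)⁻¹ * (1 + s) = 1 := inv_mul_cancel₀ hs1.ne'
  let g : List (Option (Fin (m + 1))) → ℝ := fun w =>
    s ^ nn19 w * (((1 + s)⁻¹) ^ cand19 n 0 (xw19 w) * Real.exp (-(h' * (xw19 w).length)))
  have hg : ∀ w, 0 ≤ g w := fun w => by simp only [g]; positivity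
  have key := transfer19 (D19 X L) (E19 X (2 * L + 2)) (AY19 n 0) yw19 xw19 g
    (fun u => Real.exp (-(h' * u.length))) ?_ ?_
  · refine le_trans (le_of_eq ?_) (key.trans ((sum_E19 X _ h' C hC).trans (le_of_eq (by push_cast; ring))))
    refine Finset.sum_congr rfl fun y hy => ?_
    rw [← sum_AY19, Finset.mul_sum, Finset.mul_sum]
    refine Finset.sum_congr rfl fun w hw => ?_
    obtain ⟨hv, hy', _⟩ := mem_AY19 _ _ _ _ hw
    have hlen := (len19 w).2
    have hyl := ((mem_D19 _ _ _).1 hy).1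
    simp only [g]
    rw [(cand_occ19 n w 0 hv).1, hlen, hy', hyl, mul_pow, mul_pow, pow_add, ← Real.exp_nat_mul]
    push_cast
    rw [show -(h' * ((L : ℝ) + nn19 w)) = -(h' * L) + nn19 w * (-h') by ring, Real.exp_add]
    ring
  · intro y hy w hw
    obtain ⟨hv, hy', hl⟩ := mem_AY19 _ _ _ _ hw
    have hD := (mem_D19 _ _ _).1 hy
    refine ⟨hy', (mem_E19 _ _ _).2 ⟨by rw [(len19 w).1]; omega, ?_⟩⟩
    have := goal1_lang19 hI w [] (by
      rw [hy', List.nil_append]; rintro rfl; simp at hD; omega) (by simpa [hy'] using hD.2)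
    simpa using this
  · intro x hx
    calc _ ≤ ∑ w ∈ AX19 n 0 x, g w := by
          apply Finset.sum_le_sum_of_subset_of_nonneg
          · intro w hw
            simp only [Finset.mem_filter, Finset.mem_biUnion] at hw
            obtain ⟨⟨y, hy, hw⟩, rfl⟩ := hw
            exact AX19_mem _ _ _ (mem_AY19 _ _ _ _ hw).1
          · intro w _ _; exact hg w
      _ = ∑ w ∈ AX19 n 0 x, s ^ nn19 w *
            (((1 + s)⁻¹) ^ cand19 n 0 x * Real.exp (-(h' * x.length))) := by
          refine Finset.sum_congr rfl fun w hw => ?_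
          simp only [g, (mem_AX19 _ _ _ _ hw).2]
      _ = Real.exp (-(h' * x.length)) := by
          rw [← Finset.sum_mul, sum_AX19, ← mul_assoc, ← mul_pow, mul_comm (1 + s), hs2]
          simp
      _ ≤ _ := le_rfl

/-- counting bound, deletion -/
lemma count2_19 {X : Set (ℤ → Fin (m + 1))} (hX : IsSubshift X) (hH : Hereditary X) (n : ℕ)
    (hS : Specification X n) (h' C s : ℝ)
    (hs : 0 < s) (hs1 : s < 1)
    (hC : ∀ l, ((langF X l).ncard : ℝ) ≤ C * Real.exp (h' * l)) (L : ℕ) :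
    ∑ x ∈ D19 X L, Real.exp (-(h' * L)) * ((1 + s * Real.exp h' * (1 - s)⁻¹) ^ cand19 n 0 x *
      (1 - s) ^ occ19 n 0 x) ≤ C * (L + 1) := by
  have hs0 : 0 < 1 - s := by linarith
  have hs2 : (1 - s)⁻¹ * (1 - s) = 1 := inv_mul_cancel₀ hs0.ne'
  let g : List (Option (Fin (m + 1))) → ℝ := fun w =>
    s ^ nn19 w * ((1 - s) ^ occ19 n 0 (yw19 w) * Real.exp (-(h' * (yw19 w).length)))
  have hg : ∀ w, 0 ≤ g w := fun w => by simp only [g]; positivity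
  have key := transfer19 (D19 X L) (E19 X (L + 1)) (AX19 n 0) xw19 yw19 g
    (fun u => Real.exp (-(h' * u.length))) ?_ ?_
  · refine le_trans (le_of_eq ?_) (key.trans ((sum_E19 X _ h' C hC).trans (le_of_eq (by push_cast; ring))))
    refine Finset.sum_congr rfl fun x hx => ?_
    rw [← sum_AX19, Finset.sum_mul, Finset.mul_sum]
    refine Finset.sum_congr rfl fun w hw => ?_
    obtain ⟨hv, hx'⟩ := mem_AX19 _ _ _ _ hw
    have hlen := (len19 w).2
    have hxl := ((mem_D19 _ _ _).1 hx).1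
    rw [hx', hxl] at hlen
    have ho := (cand_occ19 n w 0 hv).2
    rw [hx'] at ho
    simp only [g]
    rw [ho, hlen, mul_pow, mul_pow, pow_add, ← Real.exp_nat_mul]
    push_cast
    rw [show -(h' * (((yw19 w).length : ℝ) + nn19 w)) = -(h' * (yw19 w).length) + -(nn19 w * h')
      by ring, Real.exp_add, Real.exp_neg (nn19 w * h')]
    have := Real.exp_pos (nn19 w * h')
    have h3 : ((1 - s)⁻¹) ^ nn19 w * (1 - s) ^ nn19 w = 1 := by rw [← mul_pow, hs2, one_pow]
    have h4 : (rexp (nn19 w * h'))⁻¹ * rexp (nn19 w * h') = 1 := inv_mul_cancel₀ this.ne'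
    calc _ = (s ^ nn19 w * ((1 - s) ^ occ19 n 0 (yw19 w) * rexp (-(h' * (yw19 w).length)))) *
          (((1 - s)⁻¹) ^ nn19 w * (1 - s) ^ nn19 w) *
          ((rexp (nn19 w * h'))⁻¹ * rexp (nn19 w * h')) := by ring
      _ = _ := by rw [h3, h4]; ring
  · intro x hx w hw
    obtain ⟨hv, hx'⟩ := mem_AX19 _ _ _ _ hw
    have hD := (mem_D19 _ _ _).1 hx
    have hlen := (len19 w).2
    refine ⟨hx', (mem_E19 _ _ _).2 ⟨by rw [hx', hD.1] at hlen; omega, ?_⟩⟩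
    have := goal2_lang19 hX hH n hS w 0 [] (by omega) hv (by simpa [hx'] using hD.2)
    simpa using this
  · intro y hy
    calc _ ≤ ∑ w ∈ V19 n L 0 y, g w := by
          apply Finset.sum_le_sum_of_subset_of_nonneg
          · intro w hw
            simp only [Finset.mem_filter, Finset.mem_biUnion] at hw
            obtain ⟨⟨x, hx, hw⟩, rfl⟩ := hw
            have h1 := mem_AX19 _ _ _ _ hw
            refine V19_mem _ _ _ _ ?_ h1.1
            rw [← (len19 w).1, h1.2, ((mem_D19 _ _ _).1 hx).1]
          · intro w _ _; exact hg w
      _ = ∑ w ∈ V19 n L 0 y, s ^ nn19 w *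
            ((1 - s) ^ occ19 n 0 y * Real.exp (-(h' * y.length))) := by
          refine Finset.sum_congr rfl fun w hw => ?_
          simp only [g, mem_V19 _ _ _ _ _ hw]
      _ ≤ ((1 - s)⁻¹) ^ occ19 n 0 y * ((1 - s) ^ occ19 n 0 y * Real.exp (-(h' * y.length))) := by
          rw [← Finset.sum_mul]
          exact mul_le_mul_of_nonneg_right (sum_V19 n s hs.le hs1 _ _ _) (by positivity)
      _ = Real.exp (-(h' * y.length)) := by
          rw [← mul_assoc, ← mul_pow, hs2]
          simp
      _ ≤ _ := le_rfl

lemma growth19 (X : Set (ℤ → Fin (m + 1))) (h h' : ℝ) (hh : h < h') (h0 : 0 ≤ h')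
    (hent : Tendsto (fun n : ℕ => Real.log ((langF X n).ncard : ℝ) / (n : ℝ)) atTop (𝓝 h)) :
    ∃ C : ℝ, 0 < C ∧ ∀ l, ((langF X l).ncard : ℝ) ≤ C * Real.exp (h' * l) := by
  have h1 := (hent.eventually (gt_mem_nhds hh)).and (eventually_gt_atTop 0)
  obtain ⟨l0, hl0⟩ := eventually_atTop.1 h1
  have hnn : (0 : ℝ) ≤ ∑ l ∈ Finset.range l0, ((langF X l).ncard : ℝ) := by positivity
  refine ⟨1 + ∑ l ∈ Finset.range l0, ((langF X l).ncard : ℝ), by linarith, fun l => ?_⟩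
  have hexp : 1 ≤ Real.exp (h' * l) := Real.one_le_exp (by positivity)
  by_cases hl : l < l0
  · have : ((langF X l).ncard : ℝ) ≤ ∑ l ∈ Finset.range l0, ((langF X l).ncard : ℝ) :=
      Finset.single_le_sum (f := fun l => ((langF X l).ncard : ℝ)) (fun _ _ => by positivity)
        (Finset.mem_range.2 hl)
    nlinarith
  · obtain ⟨h2, h3⟩ := hl0 l (by omega)
    have h3' : (0 : ℝ) < l := by exact_mod_cast h3
    rw [div_lt_iff₀ h3'] at h2
    have : ((langF X l).ncard : ℝ) ≤ Real.exp (h' * l) := by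
      rcases (Nat.cast_nonneg (α := ℝ) (langF X l).ncard).eq_or_lt with h4 | h4
      · rw [← h4]; positivity
      · rw [← Real.log_le_iff_le_exp h4]; exact h2.le
    nlinarith

def wd19 (L : ℕ) (x : ℤ → Fin (m + 1)) : List (Fin (m + 1)) :=
  List.ofFn (fun i : Fin L => x ((i : ℕ) : ℤ))

lemma wd19_succ (L : ℕ) (x : ℤ → Fin (m + 1)) : wd19 (L + 1) x = wd19 L x ++ [x L] := by
  rw [wd19, List.ofFn_succ_last]
  simp [wd19]

lemma st19_append (n : ℕ) (w : List (Fin (m + 1))) (a : Fin (m + 1)) : ∀ r,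
    st19 n r (w ++ [a]) = nx19 n (st19 n r w) a := by
  induction w with
  | nil => intro r; simp [st19]
  | cons b w ih => intro r; simp [st19, ih]

lemma occ19_append (n : ℕ) (w : List (Fin (m + 1))) (a : Fin (m + 1)) : ∀ r,
    occ19 n r (w ++ [a]) = occ19 n r w + if st19 n r (w ++ [a]) = n then 1 else 0 := by
  induction w with
  | nil => intro r; simp [st19, occ19]
  | cons b w ih => intro r; simp [st19, occ19, ih]; ring

lemma cand19_append (n : ℕ) (w : List (Fin (m + 1))) (a : Fin (m + 1)) : ∀ r,
    cand19 n r (w ++ [a]) = cand19 n r w + if st19 n r w = n ∧ a = 0 then 1 else 0 := by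
  induction w with
  | nil =>
    intro r
    simp only [List.nil_append, st19, cand19]
    rw [add_zero, zero_add]
    congr
  | cons b w ih =>
    intro r
    simp only [List.cons_append, st19, cand19, ih]
    rw [add_assoc]
    congr

lemma st19_iff (n : ℕ) (x : ℤ → Fin (m + 1)) (L : ℕ) : ∀ k ≤ n,
    k ≤ st19 n 0 (wd19 L x) ↔ k ≤ L ∧ ∀ i : ℤ, (L : ℤ) - k ≤ i → i < L → x i = 0 := by
  induction L with
  | zero =>
    intro k hk
    simp only [wd19, List.ofFn_zero, st19]
    constructor
    · intro h; exact ⟨h, fun i h1 h2 => by omega⟩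
    · exact fun h => h.1
  | succ L ih =>
    intro k hk
    rw [wd19_succ, st19_append]
    cases k with
    | zero =>
      simp
      intro i h1 h2; omega
    | succ k =>
      have := ih k (by omega)
      unfold nx19
      split_ifs with hx
      · have e : k + 1 ≤ min (st19 n 0 (wd19 L x) + 1) n ↔ k ≤ st19 n 0 (wd19 L x) := by omega
        rw [e, this]
        constructor
        · rintro ⟨h1, h2⟩
          refine ⟨by omega, fun i h3 h4 => ?_⟩
          by_cases hi : i = L
          · rw [hi]; exact hx
          · exact h2 i (by push_cast at h3; omega) (by push_cast at h4; omega)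
        · rintro ⟨h1, h2⟩
          exact ⟨by omega, fun i h3 h4 => h2 i (by push_cast; omega) (by push_cast; omega)⟩
      · constructor
        · intro h; omega
        · rintro ⟨h1, h2⟩
          exact absurd (h2 L (by push_cast; omega) (by push_cast; omega)) hx

lemma st19_le (n : ℕ) (x : ℤ → Fin (m + 1)) (L : ℕ) : st19 n 0 (wd19 L x) ≤ n := by
  cases L with
  | zero => simp [wd19, st19]
  | succ L =>
    rw [wd19_succ, st19_append, nx19]
    split_ifs <;> omega

lemma st19_eq (n : ℕ) (x : ℤ → Fin (m + 1)) (L : ℕ) (hL : n ≤ L) :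
    st19 n 0 (wd19 L x) = n ↔ ∀ i : ℤ, (L : ℤ) - n ≤ i → i < L → x i = 0 := by
  have h1 := st19_iff n x L n le_rfl
  have h2 := st19_le n x L
  constructor
  · intro h; exact (h1.1 h.ge).2
  · intro h; exact le_antisymm h2 (h1.2 ⟨hL, h⟩)

/-- the set of points with `0` on `[k, k+n)` -/
def Zs19 (m : ℕ) (k n : ℕ) : Set (ℤ → Fin (m + 1)) :=
  {x | ∀ i : ℤ, (k : ℤ) ≤ i → i < k + n → x i = 0}

lemma meas_Zs19 (k n : ℕ) : MeasurableSet (Zs19 m k n) := by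
  have : Zs19 m k n = ⋂ i : ℤ, ⋂ _ : (k : ℤ) ≤ i, ⋂ _ : i < k + n, (fun x : ℤ → Fin (m + 1) => x i) ⁻¹' {0} := by
    ext x; simp [Zs19]
  rw [this]
  refine MeasurableSet.iInter fun i => MeasurableSet.iInter fun _ => MeasurableSet.iInter fun _ => ?_
  exact measurable_pi_apply i (MeasurableSet.singleton _)

lemma mu_Zs19 (μ : Measure (ℤ → Fin (m + 1))) 
    (hinv : MeasurePreserving (shiftMap (Fin (m + 1))) μ μ) (k n : ℕ) :
    μ (Zs19 m k n) = μ (Zs19 m 0 n) := by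
  induction k with
  | zero => rfl
  | succ k ih =>
    rw [← ih, ← hinv.measure_preimage (meas_Zs19 k n).nullMeasurableSet]
    congr 1
    ext x
    simp only [Zs19, shiftMap, Set.mem_preimage, Set.mem_ofPred_eq]
    constructor
    · intro h i h1 h2
      exact h (i + 1) (by push_cast; omega) (by push_cast; omega)
    · intro h i h1 h2
      have := h (i - 1) (by push_cast at h1; omega) (by push_cast at h2; omega)
      simpa using this

lemma meas_wd19 (L : ℕ) (f : List (Fin (m + 1)) → ℝ) :
    Measurable (fun x : ℤ → Fin (m + 1) => f (wd19 L x)) := by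
  have h1 : Measurable (fun (x : ℤ → Fin (m + 1)) (i : Fin L) => x ((i : ℕ) : ℤ)) :=
    measurable_pi_lambda _ fun i => measurable_pi_apply _
  have h2 : Measurable (fun w : Fin L → Fin (m + 1) => f (List.ofFn w)) := measurable_of_finite _
  exact h2.comp h1

lemma int_wd19 (μ : Measure (ℤ → Fin (m + 1))) [IsProbabilityMeasure μ] (L : ℕ)
    (f : List (Fin (m + 1)) → ℝ) :
    Integrable (fun x : ℤ → Fin (m + 1) => f (wd19 L x)) μ ∧
    ∫ x, f (wd19 L x) ∂μ = ∑ w : Fin L → Fin (m + 1),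
      (μ {x | ∀ i : Fin L, x ((i : ℕ) : ℤ) = w i}).toReal * f (List.ofFn w) := by
  have h1 : Measurable (fun (x : ℤ → Fin (m + 1)) (i : Fin L) => x ((i : ℕ) : ℤ)) :=
    measurable_pi_lambda _ fun i => measurable_pi_apply _
  have h2 : Measurable (fun w : Fin L → Fin (m + 1) => f (List.ofFn w)) := measurable_of_finite _
  have : IsProbabilityMeasure (μ.map (fun (x : ℤ → Fin (m + 1)) (i : Fin L) => x ((i : ℕ) : ℤ))) :=
    Measure.isProbabilityMeasure_map h1.aemeasurable
  have h3 : Integrable (fun w : Fin L → Fin (m + 1) => f (List.ofFn w))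
    (μ.map (fun (x : ℤ → Fin (m + 1)) (i : Fin L) => x ((i : ℕ) : ℤ))) := Integrable.of_finite
  constructor
  · exact h3.comp_measurable h1
  · have := integral_map h1.aemeasurable h2.aestronglyMeasurable (μ := μ)
    simp only [wd19]
    rw [← this, integral_fintype h3]
    refine Finset.sum_congr rfl fun w _ => ?_
    rw [smul_eq_mul, measureReal_def, Measure.map_apply h1 (MeasurableSet.singleton _)]
    congr 3
    ext x
    simp [funext_iff]

lemma E_occ19 (μ : Measure (ℤ → Fin (m + 1))) [IsProbabilityMeasure μ]
    (hinv : MeasurePreserving (shiftMap (Fin (m + 1))) μ μ) (n L : ℕ) (hL : n ≤ L) :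
    ∫ x, (occ19 n 0 (wd19 L x) : ℝ) ∂μ = ∫ x, (occ19 n 0 (wd19 n x) : ℝ) ∂μ
      + (L - n) * (μ (Zs19 m 0 n)).toReal := by
  induction L, hL using Nat.le_induction with
  | base => simp
  | succ L hL ih =>
    have e : ∀ x : ℤ → Fin (m + 1), (occ19 n 0 (wd19 (L + 1) x) : ℝ) = occ19 n 0 (wd19 L x) +
        (Zs19 m (L + 1 - n) n).indicator (fun _ => (1 : ℝ)) x := by
      intro x
      have h1 := st19_eq n x (L + 1) (by omega)
      rw [wd19_succ] at h1 ⊢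
      rw [occ19_append]
      have h2 : x ∈ Zs19 m (L + 1 - n) n ↔ st19 n 0 (wd19 L x ++ [x L]) = n := by
        rw [h1, Zs19, Set.mem_ofPred_eq]
        have e1 : ((L + 1 - n : ℕ) : ℤ) = ((L + 1 : ℕ) : ℤ) - n := by omega
        rw [e1]; simp
      by_cases h3 : st19 n 0 (wd19 L x ++ [x L]) = n
      · rw [Set.indicator_of_mem (h2.2 h3), if_pos h3]; push_cast; ring
      · rw [Set.indicator_of_notMem (fun h => h3 (h2.1 h)), if_neg h3]; push_cast; ring
    simp_rw [e]
    rw [integral_add (int_wd19 μ L (fun w => (occ19 n 0 w : ℝ))).1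
      ((integrable_const _).indicator (meas_Zs19 _ _)), integral_indicator_const _ (meas_Zs19 _ _),
      ih, measureReal_def, mu_Zs19 μ hinv (L + 1 - n)]
    simp; ring

lemma E_cand19 (μ : Measure (ℤ → Fin (m + 1))) [IsProbabilityMeasure μ]
    (hinv : MeasurePreserving (shiftMap (Fin (m + 1))) μ μ) (n L : ℕ) (hL : n ≤ L) :
    ∫ x, (cand19 n 0 (wd19 L x) : ℝ) ∂μ = ∫ x, (cand19 n 0 (wd19 n x) : ℝ) ∂μ
      + (L - n) * (μ (Zs19 m 0 (n + 1))).toReal := by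
  induction L, hL using Nat.le_induction with
  | base => simp
  | succ L hL ih =>
    have e : ∀ x : ℤ → Fin (m + 1), (cand19 n 0 (wd19 (L + 1) x) : ℝ) = cand19 n 0 (wd19 L x) +
        (Zs19 m (L - n) (n + 1)).indicator (fun _ => (1 : ℝ)) x := by
      intro x
      have h1 := st19_eq n x L hL
      rw [wd19_succ, cand19_append]
      have h2 : x ∈ Zs19 m (L - n) (n + 1) ↔ (st19 n 0 (wd19 L x) = n ∧ x L = 0) := by
        rw [h1, Zs19, Set.mem_ofPred_eq]
        have e1 : ((L - n : ℕ) : ℤ) = (L : ℤ) - n := by omega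
        rw [e1]
        constructor
        · intro h
          exact ⟨fun i h3 h4 => h i h3 (by push_cast; omega), h L (by omega) (by push_cast; omega)⟩
        · rintro ⟨h, h'⟩ i h3 h4
          by_cases hi : i = L
          · rw [hi]; exact h'
          · exact h i h3 (by push_cast at h4; omega)
      by_cases h3 : st19 n 0 (wd19 L x) = n ∧ x L = 0
      · rw [Set.indicator_of_mem (h2.2 h3), if_pos h3]; push_cast; ring
      · rw [Set.indicator_of_notMem (fun h => h3 (h2.1 h)), if_neg h3]; push_cast; ring
    simp_rw [e]
    rw [integral_add (int_wd19 μ L (fun w => (cand19 n 0 w : ℝ))).1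
      ((integrable_const _).indicator (meas_Zs19 _ _)), integral_indicator_const _ (meas_Zs19 _ _),
      ih, measureReal_def, mu_Zs19 μ hinv (L - n)]
    simp; ring

lemma lim_lin19 (f : ℕ → ℝ) (n : ℕ) (c p : ℝ) (hf : ∀ L, n ≤ L → f L = c + (L - n) * p) :
    Tendsto (fun L : ℕ => f L / L) atTop (𝓝 p) := by
  have h1 : Tendsto (fun L : ℕ => (c - n * p) / L + p) atTop (𝓝 (0 + p)) :=
    (tendsto_const_div_atTop_nhds_zero_nat _).add tendsto_const_nhds
  rw [zero_add] at h1
  refine h1.congr' ?_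
  filter_upwards [eventually_ge_atTop n, eventually_gt_atTop 0] with L h2 h3
  have : (0 : ℝ) < L := by exact_mod_cast h3
  rw [hf L h2]; field_simp; ring

lemma lim_log19 (C : ℝ) (hC : 0 < C) :
    Tendsto (fun L : ℕ => Real.log (C * (2 * L + 2)) / L) atTop (𝓝 0) := by
  have h0 : Tendsto (fun L : ℕ => C * (2 * (L : ℝ) + 2)) atTop atTop := by
    apply Tendsto.const_mul_atTop hC
    apply tendsto_atTop_add_const_right
    exact tendsto_natCast_atTop_atTop.const_mul_atTop (by norm_num)
  have h1 : Tendsto (fun x : ℝ => Real.log x / x) atTop (𝓝 0) := by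
    have := Real.isLittleO_log_id_atTop.tendsto_div_nhds_zero
    simpa using this
  have h2 := h1.comp h0
  have h3 : Tendsto (fun L : ℕ => 2 * C + (2 * C) / (L : ℝ)) atTop (𝓝 (2 * C + 0)) :=
    tendsto_const_nhds.add (tendsto_const_div_atTop_nhds_zero_nat _)
  have h4 := h2.mul h3
  rw [zero_mul] at h4
  refine h4.congr' ?_
  filter_upwards [eventually_gt_atTop 0] with L h3
  have : (0 : ℝ) < L := by exact_mod_cast h3
  simp only [Function.comp]
  field_simp

lemma measure_iUnion_of_finite19 (μ : Measure (ℤ → Fin (m + 1))) (X : Set (ℤ → Fin (m + 1)))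
    (hXm : MeasurableSet X) (L : ℕ)
    (h1 : Measurable (fun (x : ℤ → Fin (m + 1)) (i : Fin L) => x ((i : ℕ) : ℤ))) :
    μ X = ∑ w : Fin L → Fin (m + 1), μ {x ∈ X | ∀ i : Fin L, x ((i : ℕ) : ℤ) = w i} := by
  have e : X = ⋃ w ∈ (Finset.univ : Finset (Fin L → Fin (m + 1))),
      {x ∈ X | ∀ i : Fin L, x ((i : ℕ) : ℤ) = w i} := by
    ext x
    simp only [Set.mem_iUnion, Finset.mem_univ, exists_true_left, Set.mem_ofPred_eq]
    exact ⟨fun hx => ⟨fun i => x ((i : ℕ) : ℤ), hx, fun i => rfl⟩, fun ⟨w, hx, _⟩ => hx⟩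
  conv_lhs => rw [e]
  apply measure_biUnion_finset
  · intro w _ w' _ hne
    rw [Function.onFun, Set.disjoint_left]
    rintro x ⟨_, h2⟩ ⟨_, h3⟩
    exact hne (funext fun i => (h2 i).symm.trans (h3 i))
  · intro w _
    have : {x ∈ X | ∀ i : Fin L, x ((i : ℕ) : ℤ) = w i} = X ∩
        (fun (x : ℤ → Fin (m + 1)) (i : Fin L) => x ((i : ℕ) : ℤ)) ⁻¹' {w} := by
      ext x; simp [funext_iff]
    rw [this]
    exact hXm.inter (h1 (MeasurableSet.singleton _))

lemma full19 (X : Set (ℤ → Fin (m + 1))) (hX : IsSubshift X) (h : ℝ)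
    (hent : Tendsto (fun n : ℕ => Real.log ((langF X n).ncard : ℝ) / (n : ℝ)) atTop (𝓝 h))
    (hpos : 0 < h)
    (μ : Measure (ℤ → Fin (m + 1))) [IsProbabilityMeasure μ]
    (hmax : Tendsto (fun n : ℕ => entropySumF X μ n / (n : ℝ)) atTop (𝓝 h)) :
    μ Xᶜ = 0 := by
  classical
  have hXm : MeasurableSet X := hX.2.1.measurableSet
  set c := (μ X).toReal with hc
  have hsum : ∀ L, ∑ w : Fin L → Fin (m + 1),
      (μ {x ∈ X | ∀ i : Fin L, x ((i : ℕ) : ℤ) = w i}).toReal = c := by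
    intro L
    have h1 : Measurable (fun (x : ℤ → Fin (m + 1)) (i : Fin L) => x ((i : ℕ) : ℤ)) :=
      measurable_pi_lambda _ fun i => measurable_pi_apply _
    rw [hc, ← ENNReal.toReal_sum (fun _ _ => measure_ne_top _ _)]
    congr 1
    rw [← measure_iUnion_of_finite19 μ X hXm _ h1]
  have hbound : ∀ L : ℕ, entropySumF X μ L ≤ c * Real.log ((langF X L).ncard : ℝ) + 1 := by
    intro L
    have hne : (langF X L).Nonempty := by
      obtain ⟨x, hx⟩ := hX.1
      exact ⟨fun i => x ((i : ℕ) : ℤ), x, hx, fun i => rfl⟩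
    have hcard : 0 < (langF X L).ncard := (Set.ncard_pos (Set.toFinite _)).2 hne
    have := gibbs19 Finset.univ
      (fun w : Fin L → Fin (m + 1) => (μ {x ∈ X | ∀ i : Fin L, x ((i : ℕ) : ℤ) = w i}).toReal)
      (fun w => if w ∈ langF X L then 1 else 0) (fun _ _ => ENNReal.toReal_nonneg)
      (fun _ _ => by positivity) ?_ ((langF X L).ncard : ℝ) (by exact_mod_cast hcard) ?_
    · rw [hsum] at this
      have h2 : ∑ w : Fin L → Fin (m + 1),
          (μ {x ∈ X | ∀ i : Fin L, x ((i : ℕ) : ℤ) = w i}).toReal *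
            Real.log (if w ∈ langF X L then 1 else 0) = 0 := by
        refine Finset.sum_eq_zero fun w _ => ?_
        split_ifs <;> simp
      rw [h2] at this
      have h3 : 0 ≤ c := ENNReal.toReal_nonneg
      unfold entropySumF
      linarith
    · intro w _ hw
      have : w ∈ langF X L := by
        by_contra hcon
        rw [langF, Set.mem_ofPred_eq, Set.not_nonempty_iff_eq_empty] at hcon
        rw [hcon] at hw; simp at hw
      simp [this]
    · rw [Finset.sum_ite, Set.ncard_eq_toFinset_card _ (Set.toFinite _)]
      simp only [Finset.sum_const, nsmul_eq_mul, mul_one, mul_zero, add_zero, Nat.cast_le]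
      apply Finset.card_le_card
      intro w; simp
  have hlim : Tendsto (fun L : ℕ => c * (Real.log ((langF X L).ncard : ℝ) / L) + 1 / (L : ℝ)) atTop
      (𝓝 (c * h + 0)) :=
    (hent.const_mul c).add (tendsto_const_div_atTop_nhds_zero_nat _)
  have hle : h ≤ c * h + 0 := by
    refine le_of_tendsto_of_tendsto' hmax hlim fun L => ?_
    have := div_le_div_of_nonneg_right (hbound L) (Nat.cast_nonneg (α := ℝ) L)
    refine this.trans (le_of_eq ?_)
    ring
  have hc1 : 1 ≤ c := by
    by_contra hcon
    push Not at hcon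
    nlinarith
  have hX1 : μ X = 1 := by
    apply le_antisymm prob_le_one
    rw [hc] at hc1
    have := (ENNReal.ofReal_le_iff_le_toReal (measure_ne_top μ X)).2 hc1
    simpa using this
  rw [prob_compl_eq_zero_iff hXm]
  exact hX1

lemma main19 (X : Set (ℤ → Fin (m + 1))) (h : ℝ)
    (μ : Measure (ℤ → Fin (m + 1))) [IsProbabilityMeasure μ]
    (hinv : MeasurePreserving (shiftMap (Fin (m + 1))) μ μ)
    (hmax : Tendsto (fun n : ℕ => entropySumF X μ n / (n : ℝ)) atTop (𝓝 h))
    (hfull : μ Xᶜ = 0) (n : ℕ) (h' C a b : ℝ) (hC : 0 < C) (ha : 0 < a) (hb : 0 < b)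
    (hcount : ∀ L : ℕ, 0 < L → ∑ u ∈ D19 X L, Real.exp (-(h' * L)) *
      (a ^ cand19 n 0 u * b ^ occ19 n 0 u) ≤ C * (2 * L + 2)) :
    (μ (Zs19 m 0 (n + 1))).toReal * Real.log a + (μ (Zs19 m 0 n)).toReal * Real.log b ≤ h' - h := by
  classical
  have hP : ∀ S : Set (ℤ → Fin (m + 1)), μ (X ∩ S) = μ S := fun S => by
    rw [Set.inter_comm]
    exact measure_inter_conull hfull
  have hb' : ∀ L : ℕ, 0 < L → entropySumF X μ L + (-(h' * L) +
      (∫ x, (cand19 n 0 (wd19 L x) : ℝ) ∂μ) * Real.log a +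
      (∫ x, (occ19 n 0 (wd19 L x) : ℝ) ∂μ) * Real.log b) ≤ Real.log (C * (2 * L + 2)) := by
    intro L hL
    set P : (Fin L → Fin (m + 1)) → ℝ :=
      fun w => (μ {x ∈ X | ∀ i : Fin L, x ((i : ℕ) : ℤ) = w i}).toReal with hPdef
    have hP2 : ∀ w, P w = (μ {x | ∀ i : Fin L, x ((i : ℕ) : ℤ) = w i}).toReal := fun w => by
      rw [← hP]; rfl
    have hsum : ∀ f : List (Fin (m + 1)) → ℝ,
        ∫ x, f (wd19 L x) ∂μ = ∑ w, P w * f (List.ofFn w) := fun f => by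
      rw [(int_wd19 μ L f).2]
      exact Finset.sum_congr rfl fun w _ => by rw [hP2]
    have hone : ∑ w, P w = 1 := by
      have := hsum (fun _ => 1)
      simpa using this.symm
    have hlang : ∀ w, 0 < P w → w ∈ langF X L := by
      intro w hw
      by_contra hcon
      rw [langF, Set.mem_ofPred_eq, Set.not_nonempty_iff_eq_empty] at hcon
      simp only [hPdef] at hw
      rw [hcon] at hw; simp at hw
    let Z : List (Fin (m + 1)) → ℝ := fun u => Real.exp (-(h' * L)) *
      (a ^ cand19 n 0 u * b ^ occ19 n 0 u)
    have hZ : ∀ u, 0 < Z u := fun u => by simp only [Z]; positivity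
    have g := gibbs19 Finset.univ P (fun w => if w ∈ langF X L then Z (List.ofFn w) else 0)
      (fun _ _ => ENNReal.toReal_nonneg)
      (fun w _ => by split_ifs; exacts [(hZ _).le, le_rfl])
      (fun w _ hw => by rw [if_pos (hlang w hw)]; exact hZ _) (C * (2 * L + 2)) (by positivity)
      (by
        refine le_trans (le_of_eq ?_) (hcount L hL)
        rw [sum_D19, ← Finset.sum_filter]
        refine Finset.sum_congr ?_ fun _ _ => rfl
        ext w; simp)
    rw [hone] at g
    have e : ∑ w, P w * Real.log (if w ∈ langF X L then Z (List.ofFn w) else 0) =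
        -(h' * L) + (∫ x, (cand19 n 0 (wd19 L x) : ℝ) ∂μ) * Real.log a +
      (∫ x, (occ19 n 0 (wd19 L x) : ℝ) ∂μ) * Real.log b := by
      rw [hsum (fun u => (cand19 n 0 u : ℝ)), hsum (fun u => (occ19 n 0 u : ℝ)),
        Finset.sum_mul, Finset.sum_mul, ← one_mul (-(h' * (L : ℝ))), ← hone, Finset.sum_mul,
        ← Finset.sum_add_distrib, ← Finset.sum_add_distrib]
      refine Finset.sum_congr rfl fun w _ => ?_
      have hPw : 0 ≤ P w := ENNReal.toReal_nonneg
      rcases hPw.eq_or_lt with h0 | h0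
      · rw [← h0]; simp
      · rw [if_pos (hlang w h0)]
        simp only [Z]
        rw [Real.log_mul (Real.exp_pos _).ne' (by positivity), Real.log_mul (by positivity)
          (by positivity), Real.log_exp, Real.log_pow, Real.log_pow]
        ring
    rw [e] at g
    have : entropySumF X μ L = ∑ w, -(P w * Real.log (P w)) := rfl
    rw [this]
    linarith
  have l1 := lim_lin19 _ n _ _ (E_cand19 μ hinv n)
  have l2 := lim_lin19 _ n _ _ (E_occ19 μ hinv n)
  have l3 := (hmax.add (((tendsto_const_nhds (x := -h')).add (l1.mul_const (Real.log a))).add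
    (l2.mul_const (Real.log b))))
  have := le_of_tendsto_of_tendsto l3 (lim_log19 C hC) (by
    filter_upwards [eventually_gt_atTop 0] with L hL
    have hL' : (0 : ℝ) < L := by exact_mod_cast hL
    refine le_trans (le_of_eq ?_) (div_le_div_of_nonneg_right (hb' L hL) hL'.le)
    field_simp)
  linarith

lemma final1_19 (p q h : ℝ)
    (H : ∀ s, 0 < s → ∀ h', h < h' →
      q * Real.log ((1 + s)⁻¹) + p * Real.log (1 + s * Real.exp (-h') * (1 + s)⁻¹) ≤ h' - h)
    (hp : 0 ≤ p) (hq : 0 ≤ q) : p ≤ Real.exp h * q := by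
  have H1 : ∀ s, 0 < s →
      q * Real.log ((1 + s)⁻¹) + p * Real.log (1 + s * Real.exp (-h) * (1 + s)⁻¹) ≤ h - h := by
    intro s hs
    have hc : ContinuousAt (fun h' : ℝ => h' - h - (q * Real.log ((1 + s)⁻¹) +
        p * Real.log (1 + s * Real.exp (-h') * (1 + s)⁻¹))) h := by
      have : 1 + s * Real.exp (-h) * (1 + s)⁻¹ ≠ 0 := by positivity
      fun_prop (disch := assumption)
    have := ge_of_tendsto (hc.tendsto.mono_left (nhdsWithin_le_nhds (s := Set.Ioi h))) (b := 0) (by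
      filter_upwards [self_mem_nhdsWithin] with h' hh'
      have := H s hs h' hh'
      linarith)
    linarith
  have hE := Real.exp_pos (-h)
  have H2 : ∀ s, 0 < s → p * Real.exp (-h) ≤ q * (1 + s + s * Real.exp (-h)) := by
    intro s hs
    have h1 := H1 s hs
    rw [Real.log_inv, sub_self] at h1
    have h2 : Real.log (1 + s) ≤ s := by
      have := Real.log_le_sub_one_of_pos (show 0 < 1 + s by linarith); linarith
    have hu : 0 < 1 + s * Real.exp (-h) * (1 + s)⁻¹ := by positivity
    have h3 := Real.one_sub_inv_le_log_of_pos hu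
    have h4 : 1 - (1 + s * Real.exp (-h) * (1 + s)⁻¹)⁻¹ =
        s * Real.exp (-h) / (1 + s + s * Real.exp (-h)) := by
      field_simp; ring
    rw [h4] at h3
    have h5 : p * (s * Real.exp (-h) / (1 + s + s * Real.exp (-h))) ≤ q * s := by
      have := mul_le_mul_of_nonneg_left h3 hp
      have := mul_le_mul_of_nonneg_left h2 hq
      linarith
    rw [← mul_div_assoc, div_le_iff₀ (by positivity)] at h5
    have h6 : s * (p * Real.exp (-h)) ≤ s * (q * (1 + s + s * Real.exp (-h))) := by linarith
    exact le_of_mul_le_mul_left h6 hs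
  have hc : ContinuousAt (fun s : ℝ => q * (1 + s + s * Real.exp (-h))) 0 := by fun_prop
  have := ge_of_tendsto (hc.tendsto.mono_left (nhdsWithin_le_nhds (s := Set.Ioi 0)))
    (b := p * Real.exp (-h)) (by
      filter_upwards [self_mem_nhdsWithin] with s hs
      exact H2 s hs)
  have h7 : Real.exp h * Real.exp (-h) = 1 := by rw [← Real.exp_add]; simp
  calc p = Real.exp h * (p * Real.exp (-h)) := by
        rw [mul_comm p, ← mul_assoc, h7, one_mul]
    _ ≤ Real.exp h * q := by
        apply mul_le_mul_of_nonneg_left _ (Real.exp_pos _).le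
        simpa using this

lemma final2_19 (p q h : ℝ)
    (H : ∀ s, 0 < s → s < 1 → ∀ h', h < h' →
      q * Real.log (1 + s * Real.exp h' * (1 - s)⁻¹) + p * Real.log (1 - s) ≤ h' - h)
    (hp : 0 ≤ p) (hq : 0 ≤ q) : Real.exp h * q ≤ p := by
  have H1 : ∀ s, 0 < s → s < 1 →
      q * Real.log (1 + s * Real.exp h * (1 - s)⁻¹) + p * Real.log (1 - s) ≤ h - h := by
    intro s hs hs1
    have hs2 : 0 < 1 - s := by linarith
    have hc : ContinuousAt (fun h' : ℝ => h' - h - (q * Real.log (1 + s * Real.exp h' * (1 - s)⁻¹)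
        + p * Real.log (1 - s))) h := by
      have : 1 + s * Real.exp h * (1 - s)⁻¹ ≠ 0 := by positivity
      fun_prop (disch := assumption)
    have := ge_of_tendsto (hc.tendsto.mono_left (nhdsWithin_le_nhds (s := Set.Ioi h))) (b := 0) (by
      filter_upwards [self_mem_nhdsWithin] with h' hh'
      have := H s hs hs1 h' hh'
      linarith)
    linarith
  have hE := Real.exp_pos h
  have H2 : ∀ s, 0 < s → s < 1 →
      Real.exp h * q * (1 - s) ≤ p * (1 - s + s * Real.exp h) := by
    intro s hs hs1
    have hs2 : 0 < 1 - s := by linarith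
    have h1 := H1 s hs hs1
    rw [sub_self] at h1
    have h2 := Real.one_sub_inv_le_log_of_pos hs2
    have h2' : 1 - (1 - s)⁻¹ = - (s / (1 - s)) := by field_simp; ring
    rw [h2'] at h2
    have hu : 0 < 1 + s * Real.exp h * (1 - s)⁻¹ := by positivity
    have h3 := Real.one_sub_inv_le_log_of_pos hu
    have h4 : 1 - (1 + s * Real.exp h * (1 - s)⁻¹)⁻¹ =
        s * Real.exp h / (1 - s + s * Real.exp h) := by
      have : 1 - s + s * Real.exp h ≠ 0 := by positivity
      field_simp; ring
    rw [h4] at h3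
    have h5 : q * (s * Real.exp h / (1 - s + s * Real.exp h)) ≤ p * (s / (1 - s)) := by
      have := mul_le_mul_of_nonneg_left h3 hq
      have := mul_le_mul_of_nonneg_left h2 hp
      linarith
    rw [← mul_div_assoc, ← mul_div_assoc, div_le_div_iff₀ (by positivity) hs2] at h5
    have h6 : s * (Real.exp h * q * (1 - s)) ≤ s * (p * (1 - s + s * Real.exp h)) := by linarith
    exact le_of_mul_le_mul_left h6 hs
  have hc : ContinuousAt (fun s : ℝ => p * (1 - s + s * Real.exp h) - Real.exp h * q * (1 - s)) 0 := by
    fun_prop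
  have := ge_of_tendsto (hc.tendsto.mono_left (nhdsWithin_le_nhds (s := Set.Ioi 0)))
    (b := 0) (by
      filter_upwards [Ioo_mem_nhdsGT (show (0 : ℝ) < 1 by norm_num)] with s hs
      have := H2 s hs.1 hs.2
      linarith)
  simp at this
  linarith

lemma cyl_zero19 (X : Set (ℤ → Fin (m + 1))) (n : ℕ) :
    cylinderL X (List.replicate n (0 : Fin (m + 1))) = X ∩ Zs19 m 0 n := by
  ext x
  rw [mem_cyl19]
  simp only [Set.mem_inter_iff, Zs19, Set.mem_ofPred_eq, List.length_replicate,
    List.getElem_replicate]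
  refine and_congr_right fun _ => ?_
  constructor
  · intro h i h1 h2
    obtain ⟨k, rfl⟩ := Int.eq_ofNat_of_zero_le (by simpa using h1)
    exact h k (by push_cast at h2; omega)
  · intro h i hi
    exact h i (by simp) (by push_cast; omega)

end aux19

/-- Corollary (hereditary): for an i-hereditary ℤ-subshift `X ⊆ {0,…,m}^ℤ` with positive
topological entropy `h` and any MME `μ`: `μ(0ⁿ) ≤ e^h μ(0^{n+1})` for every `n ∈ ℤ₊`;
and if `X` has the specification property at distance `N`, then `μ(0^N) = e^h μ(0^{N+1})`. -/
theorem statement19 {m : ℕ}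
    (X : Set (ℤ → Fin (m + 1))) (hX : IsSubshift X)
    (hher : IHereditary X)
    (h : ℝ)
    (hent : Tendsto (fun n : ℕ => Real.log ((langF X n).ncard : ℝ) / (n : ℝ)) atTop (𝓝 h))
    (hpos : 0 < h)
    (μ : Measure (ℤ → Fin (m + 1))) [IsProbabilityMeasure μ]
    (hinv : MeasurePreserving (shiftMap (Fin (m + 1))) μ μ)
    (hmax : Tendsto (fun n : ℕ => entropySumF X μ n / (n : ℝ)) atTop (𝓝 h)) :
    (∀ n : ℕ, 0 < n →
      (μ (cylinderL X (List.replicate n (0 : Fin (m + 1))))).toReal ≤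
        Real.exp h * (μ (cylinderL X (List.replicate (n + 1) (0 : Fin (m + 1))))).toReal) ∧
    (∀ N : ℕ, Specification X N →
      (μ (cylinderL X (List.replicate N (0 : Fin (m + 1))))).toReal =
        Real.exp h * (μ (cylinderL X (List.replicate (N + 1) (0 : Fin (m + 1))))).toReal) := by
  have hfull := full19 X hX h hent hpos μ hmax
  have hP : ∀ n, μ (cylinderL X (List.replicate n (0 : Fin (m + 1)))) = μ (Zs19 m 0 n) := by
    intro n
    rw [cyl_zero19, Set.inter_comm]
    exact measure_inter_conull hfull
  have part1 : ∀ n : ℕ,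
      (μ (Zs19 m 0 n)).toReal ≤ Real.exp h * (μ (Zs19 m 0 (n + 1))).toReal := by
    intro n
    refine final1_19 _ _ h ?_ ENNReal.toReal_nonneg ENNReal.toReal_nonneg
    intro s hs h' hh'
    obtain ⟨C, hC0, hC⟩ := growth19 X h h' hh' (hpos.trans hh').le hent
    exact main19 X h μ hinv hmax hfull n h' C _ _ hC0 (by positivity) (by positivity)
      (fun L hL => count1_19 hher n h' C s hs hC L hL)
  refine ⟨fun n _ => ?_, fun N hS => ?_⟩
  · rw [hP, hP]; exact part1 n
  · rw [hP, hP]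
    refine le_antisymm (part1 N) ?_
    refine final2_19 _ _ h ?_ ENNReal.toReal_nonneg ENNReal.toReal_nonneg
    intro s hs hs1 h' hh'
    have hs2 : 0 < 1 - s := by linarith
    obtain ⟨C, hC0, hC⟩ := growth19 X h h' hh' (hpos.trans hh').le hent
    refine main19 X h μ hinv hmax hfull N h' C _ _ hC0 (by positivity) hs2
      (fun L hL => (count2_19 hX hher.1 N hS h' C s hs hs1 hC L).trans ?_)
    have : (0 : ℝ) ≤ L := Nat.cast_nonneg L
    nlinarith
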